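/- Let k be an algebraically closed field of characteristic zero and let n be an even positive integer. Let A' = k_{−1}[u^{±1}, v^{±1}] and let the dihedral group D_n = ⟨g, h : g^n = h² = (hg)² = e⟩ act by g·u = ωu, g·v = ω^{−1}v (ω a primitive nth root of unity), h·u = v, h·v = u. Then the skew group ring T' = A' # D_n is an Azumaya algebra. -/

import Mathlib

/-- `T` together with `ι : A →+* T` and `j : G → T` is the skew group ring `A # G`
for the action of the finite group `G` on `A`. -/
structure IsSkewGroupRing (A : Type*) [Ring A] (G : Type*) [Group G] [Fintype G]
    [MulSemiringAction G A] (T : Type*) [Ring T] (ι : A →+* T) (j : G → T) : Prop where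
  injective : Function.Injective ι
  j_one : j 1 = 1
  j_mul : ∀ g h : G, j g * j h = j (g * h)
  comm : ∀ (g : G) (a : A), j g * ι a = ι (g • a) * j g
  basis : ∀ t : T, ∃! c : G → A, t = ∑ g : G, ι (c g) * j g

/-- The natural map `A ⊗_{Z(A)} Aᵐᵒᵖ →ₗ End_{Z(A)}(A)`, `a ⊗ b ↦ (r ↦ a * r * b)`. -/
noncomputable def azumayaMulMap (A : Type*) [Ring A] :
    TensorProduct (Subring.center A) A Aᵐᵒᵖ →ₗ[Subring.center A]
      (A →ₗ[Subring.center A] A) :=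
  TensorProduct.lift (LinearMap.mk₂ (Subring.center A)
    (fun a b =>
      { toFun := fun r => a * r * b.unop
        map_add' := fun x y => by simp [mul_add, add_mul]
        map_smul' := fun z x => by
          have hz := Subring.mem_center_iff.mp z.2
          show a * ((z : A) * x) * b.unop = (z : A) * (a * x * b.unop)
          simp only [← mul_assoc]
          rw [hz a] })
    (fun a a' b => by ext r; simp [add_mul])
    (fun z a b => by
      ext r
      have hz := Subring.mem_center_iff.mp z.2
      show ((z : A) * a) * r * b.unop = (z : A) * (a * r * b.unop)
      simp [mul_assoc])
    (fun a b b' => by ext r; simp [mul_add])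
    (fun z a b => by
      ext r
      have hz := Subring.mem_center_iff.mp z.2
      show a * r * ((z : A) • b).unop = (z : A) * (a * r * b.unop)
      rw [MulOpposite.unop_smul]
      show a * r * ((z : A) * b.unop) = (z : A) * (a * r * b.unop)
      rw [← mul_assoc, hz (a * r), mul_assoc]))

/-- A ring is an *Azumaya algebra* (over its centre `Z`) if it is a finitely generated
projective `Z`-module and the natural map `A ⊗_Z Aᵐᵒᵖ → End_Z(A)` is bijective. -/
def IsAzumayaAlgebra (A : Type*) [Ring A] : Prop :=
  Module.Finite (Subring.center A) A ∧ Module.Projective (Subring.center A) A ∧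
    Function.Bijective (azumayaMulMap A)

/-- `f : A →+* B` exhibits `B` as the (right) Ore localization of `A` at the
submonoid `S`. -/
structure IsOreLocalization {A B : Type*} [Ring A] [Ring B] (S : Submonoid A)
    (f : A →+* B) : Prop where
  isUnit : ∀ s ∈ S, IsUnit (f s)
  num_den : ∀ b : B, ∃ a : A, ∃ s ∈ S, b * f s = f a
  ker : ∀ a : A, f a = 0 → ∃ s ∈ S, a * s = 0

/-- The relation defining the quantum plane `K_q[u,v]`: `v u = q · u v`. -/
inductive QuantumRel (K : Type*) [CommRing K] (q : K) :
    FreeAlgebra K (Fin 2) → FreeAlgebra K (Fin 2) → Prop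
  | rel : QuantumRel K q (FreeAlgebra.ι K 1 * FreeAlgebra.ι K 0)
      (q • (FreeAlgebra.ι K 0 * FreeAlgebra.ι K 1))

/-- The quantum plane `K_q[u,v] = K⟨u,v⟩/(vu - q·uv)`. -/
abbrev QuantumPlane (K : Type*) [CommRing K] (q : K) := RingQuot (QuantumRel K q)

/-- The generator `u` of the quantum plane. -/
noncomputable def qU (K : Type*) [CommRing K] (q : K) : QuantumPlane K q :=
  RingQuot.mkAlgHom K (QuantumRel K q) (FreeAlgebra.ι K 0)

/-- The generator `v` of the quantum plane. -/
noncomputable def qV (K : Type*) [CommRing K] (q : K) : QuantumPlane K q :=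
  RingQuot.mkAlgHom K (QuantumRel K q) (FreeAlgebra.ι K 1)

/-- The additive endomaps of a ring which are finite sums of maps `r ↦ p * r * q`. -/
inductive IsElementaryOperator {T : Type*} [Ring T] : (T → T) → Prop
  | mul (p q : T) : IsElementaryOperator fun r => p * r * q
  | add {φ ψ : T → T} : IsElementaryOperator φ → IsElementaryOperator ψ →
      IsElementaryOperator fun r => φ r + ψ r

namespace IsElementaryOperator

variable {T : Type*} [Ring T] {φ : T → T}

theorem sandwich (hφ : IsElementaryOperator φ) (p q a b : T) :
    IsElementaryOperator fun r => p * φ (a * r * b) * q := by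
  induction hφ with
  | mul p' q' => simpa only [mul_assoc] using mul (p * p' * a) (b * q' * q)
  | add _ _ h₁ h₂ => simpa only [mul_add, add_mul] using add h₁ h₂

theorem comp {ψ : T → T} (hφ : IsElementaryOperator φ) (hψ : IsElementaryOperator ψ) :
    IsElementaryOperator fun r => φ (ψ r) := by
  induction hφ with
  | mul p q => simpa only [one_mul, mul_one] using hψ.sandwich p q 1 1
  | add _ _ h₁ h₂ => exact add h₁ h₂

theorem sum {κ : Type*} (s : Finset κ) {φ : κ → T → T}
    (hφ : ∀ i ∈ s, IsElementaryOperator (φ i)) :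
    IsElementaryOperator fun r => ∑ i ∈ s, φ i r := by
  classical
  induction s using Finset.induction_on with
  | empty => simpa using mul (0 : T) 0
  | insert i s hi ih =>
    simp only [Finset.sum_insert hi]
    exact add (hφ i (by simp)) (ih fun j hj => hφ j (by simp [hj]))

theorem map_add (hφ : IsElementaryOperator φ) (r s : T) : φ (r + s) = φ r + φ s := by
  induction hφ with
  | mul p q => simp only [mul_add, add_mul]
  | add _ _ h₁ h₂ => simp only [h₁, h₂]; abel

theorem map_sum (hφ : IsElementaryOperator φ) {κ : Type*} (s : Finset κ) (f : κ → T) :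
    φ (∑ i ∈ s, f i) = ∑ i ∈ s, φ (f i) :=
  _root_.map_sum (AddMonoidHom.mk' φ hφ.map_add) f s

theorem map_center_mul (hφ : IsElementaryOperator φ) {z : T} (hz : z ∈ Subring.center T)
    (r : T) : φ (z * r) = z * φ r := by
  induction hφ with
  | mul p q =>
    have := Subring.mem_center_iff.mp hz p
    simp only [← mul_assoc, this]
  | add _ _ h₁ h₂ => simp only [h₁, h₂, mul_add]

open TensorProduct in
theorem exists_preimage (hφ : IsElementaryOperator φ) :
    ∃ t : T ⊗[Subring.center T] Tᵐᵒᵖ, ∀ r, azumayaMulMap T t r = φ r := by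
  induction hφ with
  | mul p q => exact ⟨p ⊗ₜ MulOpposite.op q, fun r => rfl⟩
  | add _ _ h₁ h₂ =>
    obtain ⟨t₁, h₁⟩ := h₁
    obtain ⟨t₂, h₂⟩ := h₂
    exact ⟨t₁ + t₂, fun r => by simp [h₁, h₂]⟩

open TensorProduct in
theorem exists_contraction (hφ : IsElementaryOperator φ) :
    ∃ F : T ⊗[Subring.center T] Tᵐᵒᵖ →+ T,
      (∀ a b, F (a ⊗ₜ MulOpposite.op b) = a * φ b) ∧ ∀ t, azumayaMulMap T t = 0 → F t = 0 := by
  induction hφ with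
  | mul p q =>
    refine ⟨{ toFun := fun t => azumayaMulMap T t p * q
              map_zero' := by simp
              map_add' := fun s t => by simp [add_mul] }, fun a b => ?_, fun t ht => ?_⟩
    · change a * p * b * q = a * (p * b * q)
      simp only [mul_assoc]
    · simp [ht]
  | add _ _ h₁ h₂ =>
    obtain ⟨F₁, h₁, h₁'⟩ := h₁
    obtain ⟨F₂, h₂, h₂'⟩ := h₂
    exact ⟨F₁ + F₂, fun a b => by simp [h₁, h₂, mul_add],
      fun t ht => by simp [h₁' t ht, h₂' t ht]⟩

end IsElementaryOperator

open TensorProduct in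
/-- A ring with a finite dual basis over its centre whose coordinate functions are elementary
operators is Azumaya. -/
theorem IsAzumayaAlgebra.of_elementary_dualBasis {T : Type*} [Ring T] {κ : Type*} [Fintype κ]
    (x : κ → T) (φ : κ → T → T) (hφ : ∀ i, IsElementaryOperator (φ i))
    (hcen : ∀ i r, φ i r ∈ Subring.center T) (hx : ∀ r, ∑ i, φ i r * x i = r) :
    IsAzumayaAlgebra T := by
  let Z := Subring.center T
  let coord : T →ₗ[Z] (κ → Z) :=
    { toFun := fun r i => ⟨φ i r, hcen i r⟩
      map_add' := fun r s => by ext i; exact (hφ i).map_add r s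
      map_smul' := fun z r => by ext i; exact (hφ i).map_center_mul z.2 r }
  let comb : (κ → Z) →ₗ[Z] T := Fintype.linearCombination Z x
  have hcc : comb ∘ₗ coord = LinearMap.id := by
    ext r
    simp only [comb, LinearMap.comp_apply, Fintype.linearCombination_apply]
    exact hx r
  refine ⟨Module.Finite.of_surjective comb fun r => ⟨coord r, LinearMap.congr_fun hcc r⟩,
    Module.Projective.of_split coord comb hcc, ?_, ?_⟩
  · rw [injective_iff_map_eq_zero]
    intro t ht
    choose F hF hF0 using fun i => (hφ i).exists_contraction
    have key : ∀ t : T ⊗[Z] Tᵐᵒᵖ, t = ∑ i, F i t ⊗ₜ[Z] MulOpposite.op (x i) := by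
      intro t
      induction t using TensorProduct.induction_on with
      | zero => simp
      | add s t hs ht =>
        simp only [_root_.map_add, TensorProduct.add_tmul, Finset.sum_add_distrib]
        rw [← hs, ← ht]
      | tmul a b =>
        induction b using MulOpposite.rec' with
        | _ b =>
        conv_lhs => rw [← hx b, Finset.op_sum, TensorProduct.tmul_sum]
        refine Finset.sum_congr rfl fun i _ => ?_
        have h1 : MulOpposite.op (φ i b * x i)
            = (⟨φ i b, hcen i b⟩ : Z) • MulOpposite.op (x i) := rfl
        have h2 : a * φ i b = (⟨φ i b, hcen i b⟩ : Z) • a :=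
          Subring.mem_center_iff.mp (hcen i b) a
        rw [hF, h1, h2, TensorProduct.tmul_smul, TensorProduct.smul_tmul']
    rw [key t]
    exact Finset.sum_eq_zero fun i _ => by rw [hF0 i t ht, TensorProduct.zero_tmul]
  · intro L
    choose s hs using fun i => ((hφ i).sandwich (L (x i)) 1 1 1).exists_preimage
    refine ⟨∑ i, s i, ?_⟩
    ext r
    rw [_root_.map_sum, LinearMap.sum_apply]
    conv_rhs => rw [← hx r, _root_.map_sum]
    refine Finset.sum_congr rfl fun i _ => ?_
    have h3 : L (φ i r * x i) = φ i r * L (x i) := L.map_smul ⟨φ i r, hcen i r⟩ (x i)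
    rw [hs, h3, one_mul, mul_one, mul_one]
    exact Subring.mem_center_iff.mp (hcen i r) _

section AntiCommutingUnits

variable {T : Type*} [Ring T] (U V : Tˣ)

/-- The sum of the conjugates of `r` by `1`, `U`, `V` and `V * U`. -/
def conjSum (r : T) : T :=
  r + U * r * ↑U⁻¹ + V * r * ↑V⁻¹ + V * U * r * ↑U⁻¹ * ↑V⁻¹

theorem isElementaryOperator_conjSum : IsElementaryOperator (conjSum U V) := by
  have h := (((IsElementaryOperator.mul (1 : T) 1).add (.mul (U : T) ↑U⁻¹)).add (.mul (V : T) ↑V⁻¹)).add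
    (.mul (V * U : T) (↑U⁻¹ * ↑V⁻¹))
  simp only [one_mul, mul_one, ← mul_assoc] at h
  exact h

variable {U V}

theorem commute_conjSum_left (hVU : (V : T) * U = -(U * V)) {r : T}
    (hU : Commute (U * U : T) r) : Commute (U : T) (conjSum U V r) := by
  have h1 : (U : T) * (U * r * ↑U⁻¹) = r * U := by
    rw [← mul_assoc, ← mul_assoc, hU.eq]; simp [mul_assoc]
  have h2 : (U : T) * V = -(V * U) := by rw [hVU, neg_neg]
  have h3 : (↑V⁻¹ : T) * U = -(U * ↑V⁻¹) := by
    rw [Units.inv_mul_eq_iff_eq_mul, mul_neg, ← mul_assoc, hVU]; simp [mul_assoc]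
  have h4 : (U : T) * (V * r * ↑V⁻¹) = V * U * r * ↑U⁻¹ * ↑V⁻¹ * U := by
    simp only [mul_assoc, h3, mul_neg, Units.inv_mul_cancel_left]
    simp only [← mul_assoc, h2, neg_mul]
  have h5 : (U : T) * (V * U * r * ↑U⁻¹ * ↑V⁻¹) = V * r * ↑V⁻¹ * U := by
    calc (U : T) * (V * U * r * ↑U⁻¹ * ↑V⁻¹) = -(V * (U * (U * r * ↑U⁻¹)) * ↑V⁻¹) := by
          simp only [← mul_assoc, h2, neg_mul]
      _ = _ := by rw [h1]; simp only [mul_assoc, h3, mul_neg]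
  have h6 : U * r * ↑U⁻¹ * U = U * r := by simp [mul_assoc]
  unfold conjSum
  simp only [Commute, SemiconjBy, mul_add, add_mul]
  rw [h1, h4, h5, h6]
  abel

theorem commute_conjSum_right (hVU : (V : T) * U = -(U * V)) {r : T}
    (hV : Commute (V * V : T) r) : Commute (V : T) (conjSum U V r) := by
  have h1 : (V : T) * (V * r * ↑V⁻¹) = r * V := by
    rw [← mul_assoc, ← mul_assoc, hV.eq]; simp [mul_assoc]
  have h3 : (↑U⁻¹ : T) * V = -(V * ↑U⁻¹) := by
    rw [Units.inv_mul_eq_iff_eq_mul, mul_neg, ← mul_assoc, ← neg_mul, ← hVU]; simp [mul_assoc]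
  have hc : Commute (V * V : T) U := by
    simp only [Commute, SemiconjBy]
    rw [mul_assoc, hVU, mul_neg, ← mul_assoc, hVU]
    simp [mul_assoc]
  have h4 : (V : T) * (V * U * r * ↑U⁻¹ * ↑V⁻¹) = U * r * ↑U⁻¹ * V := by
    have hc' : Commute (V * V : T) (U * r * ↑U⁻¹) :=
      (hc.mul_right hV).mul_right hc.units_inv_right
    calc (V : T) * (V * U * r * ↑U⁻¹ * ↑V⁻¹) = V * V * (U * r * ↑U⁻¹) * ↑V⁻¹ := by
          simp only [mul_assoc]
      _ = _ := by rw [hc'.eq]; simp [mul_assoc]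
  have h6 : V * r * ↑V⁻¹ * V = V * r := by simp [mul_assoc]
  have h7 : V * U * r * ↑U⁻¹ * ↑V⁻¹ * V = V * (U * r * ↑U⁻¹) := by simp [mul_assoc]
  unfold conjSum
  simp only [Commute, SemiconjBy, mul_add, add_mul]
  rw [h1, h4, h6, h7]
  abel

theorem sum_conjSum_mul (hVU : (V : T) * U = -(U * V)) (r : T) :
    conjSum U V r + conjSum U V (r * ↑U⁻¹) * U + conjSum U V (r * ↑V⁻¹) * V
      + conjSum U V (r * ↑(V * U)⁻¹) * ↑(V * U) = 4 * r := by
  have h3 : (↑V⁻¹ : T) * U = -(U * ↑V⁻¹) := by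
    rw [Units.inv_mul_eq_iff_eq_mul, mul_neg, ← mul_assoc, hVU]; simp [mul_assoc]
  have h4 : (V : T) * ↑U⁻¹ = -(↑U⁻¹ * V) := by
    rw [eq_comm, neg_eq_iff_eq_neg, Units.inv_mul_eq_iff_eq_mul, mul_neg, ← mul_assoc,
      ← neg_mul, ← hVU]
    simp [mul_assoc]
  have h5 : (↑V⁻¹ : T) * ↑U⁻¹ = -(↑U⁻¹ * ↑V⁻¹) := by
    rw [Units.inv_mul_eq_iff_eq_mul, mul_neg, ← mul_assoc, h4]; simp [mul_assoc]
  have a3 (x : T) : (↑V⁻¹ : T) * (U * x) = -(U * (↑V⁻¹ * x)) := by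
    simp only [← mul_assoc, h3, neg_mul]
  have e : (4 : T) = 1 + 1 + 1 + 1 := by norm_num
  simp only [conjSum, mul_inv_rev, Units.val_mul, add_mul, mul_assoc, hVU, h3, h5, a3, mul_neg,
    neg_mul, neg_neg, Units.inv_mul, Units.inv_mul_cancel_left, mul_one, e, one_mul]
  abel

end AntiCommutingUnits

section Assembly

variable {T G : Type*} [Ring T] [Group G] [Fintype G]

/-- A ring spanned over a subring `A` by the image of a finite group `G` normalising `A` is Azumaya
when an element `z` of order two acts on `A` as conjugation by `U * V` and `G / {1, z}` acts on the
centralizer of `A` in a Galois way, as witnessed by the families `d` and `e`. -/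
theorem IsAzumayaAlgebra.of_galois_coordinates (k) [Field k] [CharZero k] [Algebra k T]
    (j : G →* T) (A : Subring T) (U V : Tˣ) (hUA : (U : T) ∈ A) (hVA : (V : T) ∈ A)
    (hVU : (V : T) * U = -(U * V))
    (hA : ∀ t : T, Commute t U → Commute t V → ∀ a ∈ A, Commute t a)
    (hnorm : ∀ σ, ∀ a ∈ A, ∃ b ∈ A, j σ * a = b * j σ)
    (hspan : ∀ t : T, ∃ c : G → T, (∀ σ, c σ ∈ A) ∧ t = ∑ σ, c σ * j σ)
    (z : G) (hz : z ≠ 1) (w : T) (hwU : Commute w U) (hwV : Commute w V)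
    (hwz : w * (U * V) = j z)
    {J : Type*} [Fintype J] (d e : J → T)
    (hdU : ∀ i, Commute (d i) U) (hdV : ∀ i, Commute (d i) V)
    (heU : ∀ i, Commute (e i) U) (heV : ∀ i, Commute (e i) V)
    (hδ : ∀ σ, σ = 1 ∨ σ = z → ∑ i, e i * (j σ * d i * j σ⁻¹) = 1)
    (hδ' : ∀ σ, ¬ (σ = 1 ∨ σ = z) → ∑ i, e i * (j σ * d i * j σ⁻¹) = 0) :
    IsAzumayaAlgebra T := by
  classical
  have hj1 (σ : G) : j σ * j σ⁻¹ = 1 := by rw [← map_mul]; simp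
  have hj2 (σ : G) : j σ⁻¹ * j σ = 1 := by rw [← map_mul]; simp
  have hUU : Commute (U * U : T) V := by
    simp only [Commute, SemiconjBy]
    rw [← mul_assoc, hVU, mul_assoc, neg_mul, mul_assoc, hVU]
    simp
  have hVV : Commute (V * V : T) U := by
    simp only [Commute, SemiconjBy]
    rw [mul_assoc, hVU, mul_neg, ← mul_assoc, hVU]
    simp [mul_assoc]
  have hUU' : Commute (U * U : T) U := (Commute.refl _).mul_left (Commute.refl _)
  have hVV' : Commute (V * V : T) V := (Commute.refl _).mul_left (Commute.refl _)
  let B : Subring T := Subring.centralizer {w, (U * U : T), (V * V : T)}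
  have memB (t : T) :
      t ∈ B ↔ Commute w t ∧ Commute (U * U : T) t ∧ Commute (V * V : T) t := by
    simp [B, Subring.mem_centralizer_iff, Commute, SemiconjBy]
  have hAB : ∀ a ∈ A, a ∈ B := fun a ha => (memB a).2
    ⟨hA _ hwU hwV a ha, hA _ hUU' hUU a ha, hA _ hVV hVV' a ha⟩
  have hzB : j z ∈ B := (memB _).2 <| by
    rw [← hwz]
    exact ⟨(Commute.refl w).mul_right (hwU.mul_right hwV),
      ((hwU.mul_right hwU).symm.mul_right (hUU'.mul_right hUU)),
      ((hwV.mul_right hwV).symm.mul_right (hVV.mul_right hVV'))⟩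
  have inv_mem (u : Tˣ) (hu : (u : T) ∈ B) : (↑u⁻¹ : T) ∈ B := by
    rw [memB] at hu ⊢
    exact ⟨hu.1.units_inv_right, hu.2.1.units_inv_right, hu.2.2.units_inv_right⟩
  let P : T → T := fun t => ∑ i, e i * t * d i
  have hP : IsElementaryOperator P := .sum _ fun i _ => .mul _ _
  have hPa (σ : G) (a : T) (ha : a ∈ A) :
      P (a * j σ) = if σ = 1 ∨ σ = z then a * j σ else 0 := by
    have h1 : P (a * j σ) = a * (∑ i, e i * (j σ * d i * j σ⁻¹)) * j σ := by
      simp only [P, Finset.mul_sum, Finset.sum_mul]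
      refine Finset.sum_congr rfl fun i _ => ?_
      rw [← mul_assoc (e i) a, (hA _ (heU i) (heV i) a ha).eq]
      simp only [mul_assoc, hj2, mul_one]
    rw [h1]
    split_ifs with h
    · rw [hδ σ h, mul_one]
    · rw [hδ' σ h, mul_zero, zero_mul]
  have hPB (t : T) : P t ∈ B := by
    obtain ⟨c, hc, rfl⟩ := hspan t
    rw [hP.map_sum]
    refine sum_mem fun σ _ => ?_
    rw [hPa σ _ (hc σ)]
    split_ifs with h
    · refine mul_mem (hAB _ (hc σ)) ?_
      rcases h with rfl | rfl
      · simp [one_mem]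
      · exact hzB
    · exact zero_mem _
  have sum_H (f : G → T) : (∑ σ, if σ = 1 ∨ σ = z then f σ else 0) = f 1 + f z := by
    rw [← Finset.sum_filter, show (Finset.univ.filter fun σ : G => σ = 1 ∨ σ = z) = {1, z} by
      ext; simp, Finset.sum_pair hz.symm]
  have recP (t : T) : ∑ ρ, P (t * j ρ⁻¹) * j ρ = 2 * t := by
    obtain ⟨c, hc, rfl⟩ := hspan t
    simp only [Finset.sum_mul, hP.map_sum, Finset.mul_sum]
    rw [Finset.sum_comm]
    refine Finset.sum_congr rfl fun σ _ => ?_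
    have h1 (ρ : G) : P (c σ * j σ * j ρ⁻¹) * j ρ
        = if σ * ρ⁻¹ = 1 ∨ σ * ρ⁻¹ = z then c σ * j σ else 0 := by
      rw [mul_assoc, ← map_mul, hPa _ _ (hc σ), ite_mul, zero_mul, mul_assoc, ← map_mul,
        inv_mul_cancel_right]
    simp only [h1]
    rw [← Equiv.sum_comp ((Equiv.inv G).trans (Equiv.mulRight σ))]
    simp [sum_H (fun _ => c σ * j σ), two_mul]
  let Tr : T → T := fun t => ∑ σ, j σ * t * j σ⁻¹
  have hTrcen (c : T) (hU : Commute c U) (hV : Commute c V) : Tr c ∈ Subring.center T := by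
    have hTrA : ∀ a ∈ A, Commute a (Tr c) := by
      intro a ha
      refine Commute.sum_right _ _ _ fun σ _ => ?_
      obtain ⟨b, hb, hab⟩ := hnorm σ⁻¹ a ha
      have hab' : a * j σ = j σ * b := by
        calc a * j σ = j σ * (j σ⁻¹ * a) * j σ := by rw [← mul_assoc, hj1, one_mul]
          _ = _ := by rw [hab, mul_assoc, mul_assoc, hj2, mul_one]
      simp only [Commute, SemiconjBy]
      rw [← mul_assoc, ← mul_assoc, hab', mul_assoc (j σ) b c, ← (hA c hU hV b hb).eq,
        mul_assoc _ _ a, hab]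
      simp only [mul_assoc]
    have hTrG (τ : G) : Commute (j τ) (Tr c) := by
      simp only [Commute, SemiconjBy, Tr, Finset.mul_sum, Finset.sum_mul]
      rw [← Equiv.sum_comp (Equiv.mulLeft τ) fun σ => j σ * c * j σ⁻¹ * j τ]
      refine Finset.sum_congr rfl fun σ _ => ?_
      simp only [Equiv.coe_mulLeft, mul_inv_rev, map_mul, mul_assoc, hj2, mul_one]
    rw [Subring.mem_center_iff]
    intro t
    obtain ⟨x, hx, rfl⟩ := hspan t
    exact (Commute.sum_left _ _ _ fun σ _ => (hTrA _ (hx σ)).mul_left (hTrG σ)).eq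
  have recTr (c : T) (hU : Commute c U) (hV : Commute c V) (hw : Commute c w) :
      ∑ i, Tr (d i * c) * e i = 2 * c := by
    have hc1 (i : J) : Tr (d i * c) * e i = e i * Tr (d i * c) :=
      (Subring.mem_center_iff.1 (hTrcen _ ((hdU i).mul_left hU) ((hdV i).mul_left hV)) _).symm
    have hcz : j z * c = c * j z := by
      rw [← hwz]; exact (hw.mul_right (hU.mul_right hV)).symm.eq
    simp only [hc1, Tr, Finset.mul_sum]
    rw [Finset.sum_comm]
    have h2 (σ : G) : ∑ i, e i * (j σ * (d i * c) * j σ⁻¹)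
        = if σ = 1 ∨ σ = z then j σ * c * j σ⁻¹ else 0 := by
      have : ∑ i, e i * (j σ * (d i * c) * j σ⁻¹)
          = (∑ i, e i * (j σ * d i * j σ⁻¹)) * (j σ * c * j σ⁻¹) := by
        rw [Finset.sum_mul]
        refine Finset.sum_congr rfl fun i _ => ?_
        have : j σ⁻¹ * (j σ * (c * j σ⁻¹)) = c * j σ⁻¹ := by rw [← mul_assoc, hj2, one_mul]
        simp only [mul_assoc, this]
      rw [this]
      split_ifs with h
      · rw [hδ σ h, one_mul]
      · rw [hδ' σ h, zero_mul]
    simp only [h2, sum_H (fun σ => j σ * c * j σ⁻¹), hcz]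
    rw [mul_assoc c, hj1]
    simp [two_mul]
  let M : Fin 4 → Tˣ := ![1, U, V, V * U]
  have hMB (m : Fin 4) : (M m : T) ∈ B := by
    have h1 := hAB _ hUA
    have h2 := hAB _ hVA
    fin_cases m
    · exact one_mem B
    · exact h1
    · exact h2
    · exact mul_mem h2 h1
  let E : G × Fin 4 → T → T := fun x r => conjSum U V (P (r * j x.1⁻¹) * ↑(M x.2)⁻¹)
  have hE (x : G × Fin 4) : IsElementaryOperator (E x) := by
    have h := (isElementaryOperator_conjSum U V).comp
      (hP.sandwich 1 (↑(M x.2)⁻¹ : T) 1 (j x.1⁻¹))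
    simpa only [one_mul] using h
  have hEB (x : G × Fin 4) (r : T) : P (r * j x.1⁻¹) * ↑(M x.2)⁻¹ ∈ B := mul_mem (hPB _) (inv_mem _ (hMB _))
  have hEU (x : G × Fin 4) (r : T) : Commute (E x r) U :=
    (commute_conjSum_left hVU ((memB _).1 (hEB x r)).2.1).symm
  have hEV (x : G × Fin 4) (r : T) : Commute (E x r) V :=
    (commute_conjSum_right hVU ((memB _).1 (hEB x r)).2.2).symm
  have hEw (x : G × Fin 4) (r : T) : Commute (E x r) w := by
    have h1 := ((memB _).1 (hEB x r)).1
    have h2 := hwU.units_inv_right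
    have h3 := hwV.units_inv_right
    exact (((h1.add_right ((hwU.mul_right h1).mul_right h2)).add_right
      ((hwV.mul_right h1).mul_right h3)).add_right
      ((((hwV.mul_right hwU).mul_right h1).mul_right h2).mul_right h3)).symm
  have recE (r : T) : ∑ x, E x r * (↑(M x.2) * j x.1) = 8 * r := by
    rw [Fintype.sum_prod_type]
    have h1 (ρ : G) : ∑ m, E (ρ, m) r * (↑(M m) * j ρ) = 4 * (P (r * j ρ⁻¹) * j ρ) := by
      have h := sum_conjSum_mul hVU (P (r * j ρ⁻¹))
      rw [← mul_assoc 4, ← h, Fin.sum_univ_four]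
      simp [E, M, add_mul, mul_assoc]
    simp only [h1, ← Finset.mul_sum, recP]
    rw [← mul_assoc]; norm_num
  refine IsAzumayaAlgebra.of_elementary_dualBasis (κ := (G × Fin 4) × J)
    (fun y => (16⁻¹ : k) • (e y.2 * (↑(M y.1.2) * j y.1.1)))
    (fun y r => Tr (d y.2 * E y.1 r)) (fun y => ?_) (fun y r => ?_) fun r => ?_
  · refine .sum _ fun σ _ => ?_
    have := (hE y.1).sandwich (j σ * d y.2) (j σ⁻¹) 1 1
    simpa [mul_assoc] using this
  · exact hTrcen _ ((hdU _).mul_left (hEU _ _)) ((hdV _).mul_left (hEV _ _))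
  · have h2 (x) : ∑ i, Tr (d i * E x r) * (e i * (↑(M x.2) * j x.1))
        = 2 * (E x r * (↑(M x.2) * j x.1)) := by
      rw [← mul_assoc 2, ← recTr _ (hEU x r) (hEV x r) (hEw x r), Finset.sum_mul]
      simp only [mul_assoc]
    simp only [mul_smul_comm, ← Finset.smul_sum]
    rw [Fintype.sum_prod_type]
    simp only [h2, ← Finset.mul_sum, recE]
    rw [← mul_assoc, show (2 * 8 : T) = algebraMap k T 16 by norm_num [map_ofNat],
      ← Algebra.smul_def, smul_smul, inv_mul_cancel₀ (by norm_num), one_smul]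

end Assembly

section Dihedral

variable {k T G : Type*} [Field k] [Ring T] [Algebra k T] [Group G]

theorem map_pow_mul_eq_smul (j : G →* T) {g : G} {X : T} {ω : k}
    (hgX : j g * X = ω • (X * j g)) (i : ℕ) : j (g ^ i) * X = ω ^ i • (X * j (g ^ i)) := by
  induction i with
  | zero => simp
  | succ i ih =>
    rw [pow_succ', map_mul, mul_assoc, ih, mul_smul_comm, ← mul_assoc, hgX, smul_mul_assoc,
      smul_smul, ← pow_succ, mul_assoc]

theorem mul_pow_eq_smul {s X : T} {c : k} (h : s * X = c • (X * s)) (l : ℕ) :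
    s * X ^ l = c ^ l • (X ^ l * s) := by
  induction l with
  | zero => simp
  | succ l ih =>
    rw [pow_succ, ← mul_assoc, ih, smul_mul_assoc, mul_assoc, h, mul_smul_comm, smul_smul,
      ← pow_succ, ← mul_assoc]

/-- A ring spanned over a subring `A` by the image of a dihedral group of order divisible by four is
Azumaya when `A` is generated, up to centralizers, by anticommuting units `U` and `V` which are
scaled by the rotation `g` and swapped by the reflection `h`. -/
theorem IsAzumayaAlgebra.of_dihedral [CharZero k] [Fintype G]
    (j : G →* T) (A : Subring T) (U V : Tˣ) (hUA : (U : T) ∈ A) (hVA : (V : T) ∈ A)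
    (hVU : (V : T) * U = -(U * V))
    (hA : ∀ t : T, Commute t U → Commute t V → ∀ a ∈ A, Commute t a)
    (hnorm : ∀ σ, ∀ a ∈ A, ∃ b ∈ A, j σ * a = b * j σ)
    (hspan : ∀ t : T, ∃ c : G → T, (∀ σ, c σ ∈ A) ∧ t = ∑ σ, c σ * j σ)
    {m : ℕ} (hm : 0 < m) {ω : k} (hω : IsPrimitiveRoot ω (2 * m)) {g h : G}
    (hordg : orderOf g = 2 * m) (hrel : h * g * h = g⁻¹) (hh : h * h = 1)
    (hhg : h ∉ Subgroup.zpowers g) (hgen : ∀ x : G, ∃ i : ℕ, x = g ^ i ∨ x = g ^ i * h)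
    (hgU : j g * U = ω • (U * j g)) (hgV : j g * V = ω⁻¹ • (V * j g))
    (hhU : j h * U = V * j h) (hhV : j h * V = U * j h) :
    IsAzumayaAlgebra T := by
  have hω0 : ω ≠ 0 := hω.ne_zero (by omega)
  have hωm : ω ^ m = -1 := by
    have h1 : (ω ^ m) ^ 2 = 1 := by rw [← pow_mul, mul_comm, hω.pow_eq_one]
    exact (by simpa using h1 : ω ^ m = 1 ∨ ω ^ m = -1).resolve_left (hω.pow_ne_one_of_pos_of_lt hm.ne' (by omega))
  have hpow (a b : ℕ) : g ^ a = g ^ b ↔ ω ^ a = ω ^ b := by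
    rw [pow_eq_pow_iff_modEq, hordg, hω.eq_orderOf, ← Units.val_mk0 hω0, orderOf_units,
      ← pow_eq_pow_iff_modEq, Units.ext_iff, Units.val_pow_eq_pow_val, Units.val_pow_eq_pow_val]
  let z : G := g ^ m
  have hjzU : j z * U = -(U * j z) := by
    rw [map_pow_mul_eq_smul j hgU m, hωm, neg_one_smul]
  have hjzV : j z * V = -(V * j z) := by
    rw [map_pow_mul_eq_smul j hgV m, inv_pow, hωm, inv_neg_one, neg_one_smul]
  have hzz : z * z = 1 := by
    rw [← pow_add, ← two_mul, ← hordg, pow_orderOf_eq_one]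
  have hj1 (σ : G) : j σ * j σ⁻¹ = 1 := by rw [← map_mul]; simp
  let W : Tˣ := Units.map j (toUnits z) * (U * V)⁻¹
  have hwz : (W : T) * (U * V) = j z := by
    have : W * (U * V) = Units.map j (toUnits z) := by
      rw [inv_mul_cancel_right]
    simpa using congrArg Units.val this
  have cancel (a b : T) (h : a * (U * V) = b * (U * V)) : a = b :=
    (U * V).isUnit.mul_left_injective (by simpa using h)
  have hwU : Commute (W : T) U := by
    refine cancel _ _ ?_
    have h1 : (U : T) * (U * V) = -(U * V * U) := by
      rw [mul_assoc, hVU, mul_neg, neg_neg]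
    rw [mul_assoc, h1, mul_neg, ← mul_assoc, hwz, hjzU, neg_neg, mul_assoc, hwz]
  have hwV : Commute (W : T) V := by
    refine cancel _ _ ?_
    have h1 : (V : T) * (U * V) = -(U * V * V) := by
      rw [← mul_assoc, hVU, neg_mul]
    rw [mul_assoc, h1, mul_neg, ← mul_assoc, hwz, hjzV, neg_neg, mul_assoc, hwz]
  have hgW : Commute (j g) W := by
    refine cancel _ _ ?_
    have h1 : j g * (U * V) = (U * V) * j g := by
      rw [← mul_assoc, hgU, smul_mul_assoc, mul_assoc, hgV, mul_smul_comm, smul_smul,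
        mul_inv_cancel₀ hω0, one_smul, mul_assoc]
    rw [mul_assoc, hwz, mul_assoc, h1, ← mul_assoc, hwz, ← map_mul, ← map_mul, ← pow_succ,
      ← pow_succ']
  have hhz : h * z = z * h := by
    have h1 : h * g * h⁻¹ = g⁻¹ := by rw [inv_eq_of_mul_eq_one_left hh, hrel]
    have h2 : h * z * h⁻¹ = z := by
      rw [← conj_pow, h1, inv_pow]
      exact inv_eq_of_mul_eq_one_left hzz
    exact mul_inv_eq_iff_eq_mul.1 h2
  have hhW : j h * W = -(W * j h) := by
    refine cancel _ _ ?_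
    have h1 : j h * (U * V) = -((U * V) * j h) := by
      rw [← mul_assoc, hhU, mul_assoc, hhV, ← mul_assoc, hVU, neg_mul]
    rw [mul_assoc, hwz, neg_mul, mul_assoc, h1, mul_neg, neg_neg, ← mul_assoc, hwz, ← map_mul,
      ← map_mul, hhz]
  let X : Tˣ := U * U
  have hXU : Commute (X : T) U := (Commute.refl _).mul_left (Commute.refl _)
  have hXV : Commute (X : T) V := by
    simp only [Commute, SemiconjBy, X, Units.val_mul]
    rw [← mul_assoc, hVU, mul_assoc, neg_mul, mul_assoc, hVU]
    simp
  have rot_sum (i : ℕ) : ∑ x : Fin m × Fin 2,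
      (↑(X ^ (x.1 : ℕ) * W ^ (x.2 : ℕ))⁻¹ : T) * (j (g ^ i) * (((2 * m : ℕ) : k)⁻¹ •
        ((X : T) ^ (x.1 : ℕ) * (W : T) ^ (x.2 : ℕ))) * j (g ^ i)⁻¹)
      = ((m : k)⁻¹ * ∑ l ∈ Finset.range m, ((ω ^ i) ^ 2) ^ l) • (1 : T) := by
    have hX : j (g ^ i) * (X : T) = (ω ^ i) ^ 2 • ((X : T) * j (g ^ i)) := by
      have h1 := map_pow_mul_eq_smul j hgU i
      simp only [X, Units.val_mul]
      rw [← mul_assoc, h1, smul_mul_assoc, mul_assoc, h1, mul_smul_comm, smul_smul, ← sq,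
        mul_assoc]
    have hW : Commute (j (g ^ i)) (W : T) := by rw [map_pow]; exact hgW.pow_left i
    have hterm (l ε : ℕ) : (↑(X ^ l * W ^ ε)⁻¹ : T) * (j (g ^ i) * (((2 * m : ℕ) : k)⁻¹ •
        ((X : T) ^ l * (W : T) ^ ε)) * j (g ^ i)⁻¹)
        = (((2 * m : ℕ) : k)⁻¹ * ((ω ^ i) ^ 2) ^ l) • (1 : T) := by
      have h1 : j (g ^ i) * ((X : T) ^ l * (W : T) ^ ε) * j (g ^ i)⁻¹
          = ((ω ^ i) ^ 2) ^ l • (↑(X ^ l * W ^ ε) : T) := by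
        rw [← mul_assoc, mul_pow_eq_smul hX, smul_mul_assoc, mul_assoc, (hW.pow_right ε).eq,
          smul_mul_assoc, mul_assoc, mul_assoc, hj1, mul_one]
        push_cast
        rfl
      rw [mul_smul_comm, smul_mul_assoc, h1, smul_smul, mul_smul_comm, Units.inv_mul]
    simp only [hterm]
    rw [← Finset.sum_smul, Fintype.sum_prod_type, Finset.mul_sum,
      ← Fin.sum_univ_eq_sum_range (fun l => (m : k)⁻¹ * ((ω ^ i) ^ 2) ^ l)]
    congr 1
    refine Finset.sum_congr rfl fun l _ => ?_
    rw [Fin.sum_univ_two]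
    push_cast
    field_simp
    norm_num
  have rot_iff (i : ℕ) : (g ^ i = 1 ∨ g ^ i = z) ↔ (ω ^ i) ^ 2 = 1 := by
    rw [← pow_zero g, hpow, hpow, hωm, pow_zero]
    simp
  have ref_ne (i : ℕ) : ¬ (g ^ i * h = 1 ∨ g ^ i * h = z) := by
    have hgi : g ^ i ∈ Subgroup.zpowers g := Subgroup.npow_mem_zpowers g i
    intro H
    have : g ^ i * h ∈ Subgroup.zpowers g := by
      rcases H with H | H <;> rw [H]
      · exact one_mem _
      · exact Subgroup.npow_mem_zpowers g m
    exact hhg ((Subgroup.mul_mem_cancel_left _ hgi).1 this)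
  refine IsAzumayaAlgebra.of_galois_coordinates k j A U V hUA hVA hVU hA hnorm hspan z ?_ W hwU hwV
    hwz (J := Fin m × Fin 2)
    (fun x => ((2 * m : ℕ) : k)⁻¹ • ((X : T) ^ (x.1 : ℕ) * (W : T) ^ (x.2 : ℕ)))
    (fun x => ↑(X ^ (x.1 : ℕ) * W ^ (x.2 : ℕ))⁻¹)
    (fun x => ((hXU.pow_left _).mul_left (hwU.pow_left _)).smul_left _)
    (fun x => ((hXV.pow_left _).mul_left (hwV.pow_left _)).smul_left _)
    (fun x => Commute.units_inv_left <| by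
      push_cast; exact (hXU.pow_left _).mul_left (hwU.pow_left _))
    (fun x => Commute.units_inv_left <| by
      push_cast; exact (hXV.pow_left _).mul_left (hwV.pow_left _)) ?_ ?_
  · intro H
    have := (hpow m 0).1 (by simpa using H)
    rw [hωm, pow_zero] at this
    norm_num at this
  · intro σ hσ
    obtain ⟨i, rfl | rfl⟩ := hgen σ
    · rw [rot_sum, (rot_iff i).1 hσ]
      simp [hm.ne']
    · exact absurd hσ (ref_ne i)
  · intro σ hσ
    obtain ⟨i, rfl | rfl⟩ := hgen σ
    · rw [rot_sum]
      have hne : (ω ^ i) ^ 2 ≠ 1 := fun H => hσ ((rot_iff i).2 H)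
      have : ∑ l ∈ Finset.range m, ((ω ^ i) ^ 2) ^ l = 0 := by
        rw [geom_sum_eq hne, ← pow_mul, ← pow_mul, mul_comm, pow_mul,
          hω.pow_eq_one, one_pow, sub_self, zero_div]
      rw [this, mul_zero, zero_smul]
    · have hW : j (g ^ i * h) * (W : T) = -(W * j (g ^ i * h)) := by
        have : Commute (j (g ^ i)) (W : T) := by rw [map_pow]; exact hgW.pow_left i
        rw [map_mul, mul_assoc, hhW, mul_neg, ← mul_assoc, this.eq, mul_assoc]
      rw [Fintype.sum_prod_type]
      refine Finset.sum_eq_zero fun l _ => ?_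
      obtain ⟨b, hb, hjb⟩ := hnorm (g ^ i * h) ((X : T) ^ (l : ℕ)) (pow_mem (mul_mem hUA hUA) _)
      have hWb : (W : T) * b = b * W := hA _ hwU hwV b hb
      have h0 : j (g ^ i * h) * (X : T) ^ (l : ℕ) * j (g ^ i * h)⁻¹ = b := by
        rw [hjb, mul_assoc, hj1, mul_one]
      have h1 : j (g ^ i * h) * ((X : T) ^ (l : ℕ) * W) * j (g ^ i * h)⁻¹ = -(W * b) := by
        rw [← mul_assoc, hjb, mul_assoc b, hW, mul_neg, neg_mul, mul_assoc, mul_assoc, hj1,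
          mul_one, hWb]
      have h2 : (X ^ (l : ℕ) * W)⁻¹ = (X ^ (l : ℕ))⁻¹ * W⁻¹ := by
        have hXW : Commute X W := Units.ext (hwU.mul_right hwU).symm.eq
        rw [(hXW.pow_left _).eq, mul_inv_rev]
      rw [Fin.sum_univ_two]
      simp only [Fin.val_zero, Fin.val_one, pow_zero, pow_one, mul_one, mul_smul_comm,
        smul_mul_assoc, h0, h1, h2, Units.val_mul]
      simp [mul_assoc]

end Dihedral

section QuantumPlane

variable {k : Type*} [Field k] {q : k}

theorem qV_mul_qU : qV k q * qU k q = q • (qU k q * qV k q) := by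
  have h := RingQuot.mkAlgHom_rel k (QuantumRel.rel (K := k) (q := q))
  simp only [map_mul, map_smul] at h
  exact h

theorem QuantumPlane.mem_of_generators_mem {S : Subalgebra k (QuantumPlane k q)} (hU : qU k q ∈ S)
    (hV : qV k q ∈ S) (a : QuantumPlane k q) : a ∈ S := by
  obtain ⟨a, rfl⟩ := RingQuot.mkAlgHom_surjective k (QuantumRel k q) a
  induction a using FreeAlgebra.induction with
  | grade0 c => rw [AlgHom.commutes]; exact S.algebraMap_mem c
  | grade1 i => fin_cases i <;> assumption
  | mul a b ha hb => rw [map_mul]; exact mul_mem ha hb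
  | add a b ha hb => rw [map_add]; exact add_mem ha hb

end QuantumPlane

theorem IsOreLocalization.commute_map {A B T : Type*} [Ring A] [Ring B] [Ring T] {S : Submonoid A}
    {f : A →+* B} (hf : IsOreLocalization S f) (φ : B →+* T) {t : T}
    (ht : ∀ a, Commute t (φ (f a))) (b : B) : Commute t (φ b) := by
  obtain ⟨a, s, hs, h⟩ := hf.num_den b
  refine ((hf.isUnit s hs).map φ).mul_left_injective ?_
  have h1 : φ b * φ (f s) = φ (f a) := by rw [← map_mul, h]
  change t * φ b * φ (f s) = φ b * t * φ (f s)
  rw [mul_assoc, h1, (ht a).eq, ← h1, mul_assoc, mul_assoc, (ht s).eq]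

/-- For even `n`, the skew group ring `k_{-1}[u^{±1},v^{±1}] # D_n` is Azumaya. -/
theorem localizedMinusOnePlane_Dn_even_skewGroupRing_azumaya
    (k : Type) [Field k] [IsAlgClosed k] [CharZero k]
    (n : ℕ) (hn : 0 < n) (heven : Even n) (ω : k) (hω : IsPrimitiveRoot ω n)
    (G : Type) [Group G] [Fintype G] (g h : G)
    (hordg : orderOf g = n) (hordh : orderOf h = 2) (hrel : h * g * h = g⁻¹)
    (hcard : Fintype.card G = 2 * n)
    (hgen : ∀ x : G, ∃ i : ℕ, x = g ^ i ∨ x = g ^ i * h)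
    [MulSemiringAction G (QuantumPlane k (-1 : k))]
    [SMulCommClass G k (QuantumPlane k (-1 : k))]
    (hgu : g • qU k (-1 : k) = ω • qU k (-1 : k))
    (hgv : g • qV k (-1 : k) = ω⁻¹ • qV k (-1 : k))
    (hhu : h • qU k (-1 : k) = qV k (-1 : k)) (hhv : h • qV k (-1 : k) = qU k (-1 : k))
    (A' : Type) [Ring A'] (f : QuantumPlane k (-1 : k) →+* A')
    (hloc : IsOreLocalization (Submonoid.closure {qU k (-1 : k), qV k (-1 : k)}) f)
    [MulSemiringAction G A']
    (hequi : ∀ (x : G) (a : QuantumPlane k (-1 : k)), x • f a = f (x • a))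
    (T' : Type) [Ring T'] (iota : A' →+* T') (j : G → T')
    (hT : IsSkewGroupRing A' G T' iota j) :
    IsAzumayaAlgebra T' := by
  obtain ⟨m, hm⟩ := heven
  obtain rfl : n = 2 * m := by omega
  let R := QuantumPlane k (-1 : k)
  let γ : k →+* T' := iota.comp (f.comp (algebraMap k R))
  have hspan : ∀ t : T', ∃ c : G → T', (∀ σ, c σ ∈ iota.range) ∧ t = ∑ σ, c σ * j σ := by
    intro t
    obtain ⟨c, hc, -⟩ := hT.basis t
    exact ⟨fun σ => iota (c σ), fun σ => ⟨c σ, rfl⟩, hc⟩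
  have hγj (c : k) (σ : G) : Commute (γ c) (j σ) := by
    have h1 : σ • algebraMap k R c = algebraMap k R c := by
      rw [Algebra.algebraMap_eq_smul_one, smul_comm, smul_one]
    have h2 := hT.comm σ (f (algebraMap k R c))
    rw [hequi, h1] at h2
    exact h2.symm
  have hγ (c : k) (t : T') : γ c * t = t * γ c := by
    obtain ⟨x, hx, rfl⟩ := hspan t
    refine Commute.sum_right _ _ _ fun σ _ => Commute.mul_right ?_ (hγj c σ)
    obtain ⟨b, hb⟩ := hx σ
    rw [← hb]
    refine hloc.commute_map iota (fun a => ?_) b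
    exact ((Algebra.commute_algebraMap_left c a).map f).map iota
  let _ : Algebra k T' := γ.toAlgebra' hγ
  have hsmul (c : k) (a : R) : iota (f (c • a)) = c • iota (f a) := by
    rw [Algebra.smul_def, map_mul, map_mul]; rfl
  have hmap {σ : G} {a b : R} (hab : σ • a = b) : j σ * iota (f a) = iota (f b) * j σ := by
    rw [hT.comm, hequi, hab]
  obtain ⟨U, hU⟩ := (hloc.isUnit _ (Submonoid.subset_closure (Set.mem_insert _ _))).map iota
  obtain ⟨V, hV⟩ := (hloc.isUnit _ (Submonoid.subset_closure
    (Set.mem_insert_of_mem _ (Set.mem_singleton _)))).map iota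
  have hA : ∀ t : T', Commute t U → Commute t V → ∀ a ∈ iota.range, Commute t a := by
    rintro t htU htV _ ⟨b, rfl⟩
    refine hloc.commute_map iota (fun a => ?_) b
    let F : R →ₐ[k] T' := { iota.comp f with commutes' := fun c => rfl }
    have hF (a : R) : a ∈ (Subalgebra.centralizer k {t}).comap F ↔ Commute t (iota (f a)) := by
      rw [Subalgebra.mem_comap, Subalgebra.mem_centralizer_iff]
      exact ⟨fun h => h t rfl, by rintro h _ rfl; exact h⟩
    exact (hF a).1 (QuantumPlane.mem_of_generators_mem ((hF _).2 (hU ▸ htU)) ((hF _).2 (hV ▸ htV)) a)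
  refine IsAzumayaAlgebra.of_dihedral (k := k) (m := m) (ω := ω) (g := g) (h := h)
    { toFun := j, map_one' := hT.j_one, map_mul' := fun x y => (hT.j_mul x y).symm }
    iota.range U V ⟨_, hU.symm⟩ ⟨_, hV.symm⟩ ?_ hA ?_ hspan (by omega) hω hordg hrel ?_ ?_ hgen
    ?_ ?_ ?_ ?_
  · have h1 := congrArg (fun a => iota (f a)) (qV_mul_qU (k := k) (q := -1))
    simp only [hsmul, map_mul, neg_one_smul] at h1
    rw [hU, hV, h1]
  · rintro σ _ ⟨a, rfl⟩
    exact ⟨_, ⟨σ • a, rfl⟩, hT.comm σ a⟩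
  · rw [← sq, ← hordh, pow_orderOf_eq_one]
  · intro hhg
    have hall : ∀ x : G, x ∈ Subgroup.zpowers g := by
      intro x
      obtain ⟨i, rfl | rfl⟩ := hgen x
      · exact Subgroup.npow_mem_zpowers g i
      · exact mul_mem (Subgroup.npow_mem_zpowers g i) hhg
    have h1 := orderOf_eq_card_of_forall_mem_zpowers hall
    rw [Nat.card_eq_fintype_card, hcard, hordg] at h1
    omega
  · change j g * (U : T') = ω • ((U : T') * j g)
    rw [hU, hmap hgu, hsmul, smul_mul_assoc]
  · change j g * (V : T') = ω⁻¹ • ((V : T') * j g)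
    rw [hV, hmap hgv, hsmul, smul_mul_assoc]
  · change j h * (U : T') = V * j h
    rw [hU, hV, hmap hhu]
  · change j h * (V : T') = U * j h
    rw [hU, hV, hmap hhv]
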